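/- Let d ≥ 1, let μ be the Haar probability measure on the unitary group U(d), let ρ ∈ ℂ^{d×d} be a rank-one orthogonal projection, and let A ∈ ℂ^{d×d} be Hermitian with Tr(A) = 0. Then the Haar average of Tr(U ρ U* A) is 0 and its variance satisfies ∫_{U(d)} (Tr(U ρ U* A))² dμ(U) = Tr(A²)/(d(d+1)) ≤ ‖A‖_{HS}²/d². In particular, for a Pauli string A (which satisfies A² = I_d and Tr(A) = 0) this variance equals 1/(d+1). -/

import Mathlib

open Matrix MeasureTheory

namespace Matrix.UnitaryGroup

variable {n : Type*} [Fintype n] [DecidableEq n]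

instance instCompactSpaceComplex : CompactSpace (unitaryGroup n ℂ) := by
  refine isCompact_iff_compactSpace.mp <| IsCompact.of_isClosed_subset
    (isCompact_univ_pi fun _ : n => isCompact_univ_pi fun _ : n =>
      isCompact_closedBall (0 : ℂ) 1) ?_ fun U hU i _ j _ => ?_
  · exact isClosed_unitary
  · simpa using entry_norm_bound_of_unitary hU i j

/-- Every unit vector is the conjugate of the `i`-th row of some unitary matrix. -/
theorem exists_mulVec_apply_eq (i : n) (w : n → ℂ) (hw : star w ⬝ᵥ w = 1) :
    ∃ W : unitaryGroup n ℂ, ∀ z, ((W : Matrix n n ℂ) *ᵥ z) i = star w ⬝ᵥ z := by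
  have hnorm : ‖WithLp.toLp 2 w‖ = 1 := by
    have h : inner ℂ (WithLp.toLp 2 w) (WithLp.toLp 2 w) = 1 := by
      rw [EuclideanSpace.inner_toLp_toLp, dotProduct_comm, hw]
    have h' := congrArg Complex.re h
    rw [← RCLike.re_eq_complex_re, inner_self_eq_norm_sq] at h'
    exact (pow_eq_one_iff_of_nonneg (norm_nonneg _) two_ne_zero).mp h'
  obtain ⟨b, hb⟩ := Orthonormal.exists_orthonormalBasis_extension_of_card_eq
    (𝕜 := ℂ) (ι := n) (E := EuclideanSpace ℂ n) (by simp)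
    (v := fun _ => WithLp.toLp 2 w) (s := {i})
    ⟨fun _ => hnorm, fun a b hab => absurd (Subsingleton.elim a b) hab⟩
  refine ⟨⟨Matrix.of fun j k => star (b j k), mem_unitaryGroup_iff.mpr ?_⟩, fun z => ?_⟩
  · ext j k
    have := orthonormal_iff_ite.mp b.orthonormal j k
    rw [PiLp.inner_apply] at this
    rw [Matrix.mul_apply, Matrix.one_apply, ← this]
    simp [Matrix.star_apply, mul_comm]
  · simp [mulVec, dotProduct, hb i rfl]

end Matrix.UnitaryGroup

/-- Summation over the four relative phases `1, i, -1, -i`. -/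
theorem Complex.sum_norm_add_I_pow_mul_pow_four (x y : ℂ) :
    ∑ k ∈ Finset.range 4, ‖x + I ^ k * y‖ ^ 4 =
      4 * (‖x‖ ^ 4 + ‖y‖ ^ 4 + 4 * (‖x‖ ^ 2 * ‖y‖ ^ 2)) := by
  have h (z : ℂ) : ‖z‖ ^ 4 = (z.re * z.re + z.im * z.im) ^ 2 := by
    rw [← Complex.normSq_apply, ← Complex.sq_norm]; ring
  simp only [h, Complex.sq_norm, Complex.normSq_apply, Finset.sum_range_succ,
    Finset.sum_range_zero, I_pow_three, I_sq, pow_zero, pow_one]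
  simp
  ring

namespace Matrix

variable {n : Type*} [Fintype n]

theorem star_dotProduct_self_eq_sum_norm_sq (z : n → ℂ) :
    star z ⬝ᵥ z = ((∑ i, ‖z i‖ ^ 2 : ℝ) : ℂ) := by
  simp [dotProduct, ← Complex.conj_mul']

/-- A rank-one orthogonal projection is `v v*` for a unit vector `v`. -/
theorem exists_eq_vecMulVec_of_rank_eq_one {ρ : Matrix n n ℂ}
    (hρ : ρ.IsHermitian) (hρ2 : ρ * ρ = ρ) (hrank : ρ.rank = 1) :
    ∃ v : n → ℂ, star v ⬝ᵥ v = 1 ∧ ρ = vecMulVec v (star v) := by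
  obtain ⟨⟨u, x, hx⟩, hu0, hu⟩ := finrank_eq_one_iff'.mp hrank
  rw [mulVecLin_apply] at hx
  have hu0 : u ≠ 0 := fun h => hu0 (Subtype.ext h)
  have hρu : ρ *ᵥ u = u := by rw [← hx, mulVec_mulVec, hρ2]
  have hN := star_dotProduct_self_eq_sum_norm_sq u
  set N : ℝ := ∑ i, ‖u i‖ ^ 2
  have hNne : (N : ℂ) ≠ 0 := by
    rw [← hN]
    open scoped ComplexOrder in
      exact fun h => hu0 (dotProduct_star_self_eq_zero.mp h)
  have hN0 : 0 ≤ N := Finset.sum_nonneg fun _ _ => by positivity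
  have hs : ((√N : ℝ) : ℂ) * ((√N : ℝ) : ℂ) = N := by
    rw [← Complex.ofReal_mul, Real.mul_self_sqrt hN0]
  have hs0 : ((√N : ℝ) : ℂ) ≠ 0 := fun h => hNne (by rw [← hs, h, zero_mul])
  have hvv (z : n → ℂ) : ρ *ᵥ z = ((star u ⬝ᵥ z) / N) • u := by
    obtain ⟨c, hc⟩ := hu ⟨ρ *ᵥ z, z, rfl⟩
    have hc : c • u = ρ *ᵥ z := congrArg Subtype.val hc
    have h1 : star u ⬝ᵥ z = c * N := by
      have : star u ⬝ᵥ (ρ *ᵥ z) = star u ⬝ᵥ z := by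
        conv_rhs => rw [← hρu, star_mulVec, hρ.eq, ← dotProduct_mulVec]
      rw [← this, ← hc, dotProduct_smul, hN, smul_eq_mul]
    rw [← hc, h1, mul_div_cancel_right₀ _ hNne]
  classical
  refine ⟨((√N : ℝ) : ℂ)⁻¹ • u, ?_, ?_⟩
  · rw [star_smul, smul_dotProduct, dotProduct_smul, hN, ← hs]
    simp
    field_simp
  · ext i j
    have := congrFun (hvv (Pi.single j 1)) i
    simp at this
    rw [this, ← hs]
    simp [vecMulVec_apply]
    field_simp

theorem trace_conj_vecMulVec_mul (U A : Matrix n n ℂ) (v : n → ℂ) :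
    (U * vecMulVec v (star v) * star U * A).trace = star (U *ᵥ v) ⬝ᵥ (A *ᵥ (U *ᵥ v)) := by
  rw [mul_vecMulVec, vecMulVec_mul, vecMulVec_mul, trace_vecMulVec, star_mulVec,
    dotProduct_comm, ← dotProduct_mulVec, ← dotProduct_mulVec, ← dotProduct_mulVec]
  rfl

variable [DecidableEq n]

theorem IsHermitian.star_dotProduct_mulVec_eigenvectorUnitary {A : Matrix n n ℂ}
    (hA : A.IsHermitian) (z : n → ℂ) :
    star ((hA.eigenvectorUnitary : Matrix n n ℂ) *ᵥ z) ⬝ᵥ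
        (A *ᵥ ((hA.eigenvectorUnitary : Matrix n n ℂ) *ᵥ z)) =
      ((∑ i, hA.eigenvalues i * ‖z i‖ ^ 2 : ℝ) : ℂ) := by
  have h : (star (hA.eigenvectorUnitary : Matrix n n ℂ)) *
      (A * (hA.eigenvectorUnitary : Matrix n n ℂ)) =
      diagonal (RCLike.ofReal ∘ hA.eigenvalues) := by
    simpa [Unitary.conjStarAlgAut_star_apply, mul_assoc] using
      hA.conjStarAlgAut_star_eigenvectorUnitary
  rw [star_mulVec, ← dotProduct_mulVec, mulVec_mulVec, mulVec_mulVec, ← star_eq_conjTranspose,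
    mul_assoc, h]
  simp only [dotProduct, mulVec_diagonal, Complex.ofReal_sum]
  refine Finset.sum_congr rfl fun i _ => ?_
  simp [← Complex.conj_mul']
  ring

theorem IsHermitian.trace_mul_self_eq_sum_eigenvalues_sq {A : Matrix n n ℂ}
    (hA : A.IsHermitian) : (A * A).trace = ((∑ i, hA.eigenvalues i ^ 2 : ℝ) : ℂ) := by
  conv_lhs => rw [hA.spectral_theorem, ← map_mul, Unitary.conjStarAlgAut_apply, trace_mul_cycle]
  simp [sq]

end Matrix

namespace Matrix.UnitaryGroup

variable {n : Type*} [Fintype n] [DecidableEq n]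

theorem sum_norm_sq_mulVec (U : unitaryGroup n ℂ) {v : n → ℂ} (hv : star v ⬝ᵥ v = 1) :
    ∑ i, ‖((U : Matrix n n ℂ) *ᵥ v) i‖ ^ 2 = 1 := by
  have h := star_dotProduct_self_eq_sum_norm_sq ((U : Matrix n n ℂ) *ᵥ v)
  rw [star_mulVec, ← dotProduct_mulVec, mulVec_mulVec, ← star_eq_conjTranspose,
    UnitaryGroup.star_mul_self, one_mulVec, hv] at h
  exact_mod_cast h.symm

variable [MeasurableSpace (unitaryGroup n ℂ)] [BorelSpace (unitaryGroup n ℂ)]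
  (μ : Measure (unitaryGroup n ℂ))

theorem integrable_comp_mulVec [IsFiniteMeasure μ] {g : (n → ℂ) → ℝ} (hg : Continuous g)
    (v : n → ℂ) : Integrable (fun U : unitaryGroup n ℂ => g ((U : Matrix n n ℂ) *ᵥ v)) μ :=
  (show Continuous fun U : unitaryGroup n ℂ => g ((U : Matrix n n ℂ) *ᵥ v) by
    fun_prop).integrable_of_hasCompactSupport (HasCompactSupport.of_compactSpace _)

theorem integral_comp_mulVec_mulVec [μ.IsMulLeftInvariant] {E : Type*} [NormedAddCommGroup E]
    [NormedSpace ℝ E] (g : (n → ℂ) → E) (W : unitaryGroup n ℂ) (v : n → ℂ) :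
    ∫ U : unitaryGroup n ℂ, g ((W : Matrix n n ℂ) *ᵥ ((U : Matrix n n ℂ) *ᵥ v)) ∂μ =
      ∫ U : unitaryGroup n ℂ, g ((U : Matrix n n ℂ) *ᵥ v) ∂μ := by
  simpa using integral_mul_left_eq_self (μ := μ)
    (fun U : unitaryGroup n ℂ => g ((U : Matrix n n ℂ) *ᵥ v)) W

theorem integral_comp_dotProduct_mulVec [μ.IsMulLeftInvariant] (g : ℂ → ℝ) (i : n)
    (w v : n → ℂ) (hw : star w ⬝ᵥ w = 1) :
    ∫ U : unitaryGroup n ℂ, g (star w ⬝ᵥ ((U : Matrix n n ℂ) *ᵥ v)) ∂μ =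
      ∫ U : unitaryGroup n ℂ, g (((U : Matrix n n ℂ) *ᵥ v) i) ∂μ := by
  obtain ⟨W, hW⟩ := exists_mulVec_apply_eq i w hw
  simpa [← hW] using integral_comp_mulVec_mulVec μ (fun z => g (z i)) W v

theorem integral_comp_mulVec_apply_eq [μ.IsMulLeftInvariant] (g : ℂ → ℝ) (i j : n)
    (v : n → ℂ) :
    ∫ U : unitaryGroup n ℂ, g (((U : Matrix n n ℂ) *ᵥ v) i) ∂μ =
      ∫ U : unitaryGroup n ℂ, g (((U : Matrix n n ℂ) *ᵥ v) j) ∂μ := by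
  simpa [← Pi.single_star] using
    integral_comp_dotProduct_mulVec μ g j (Pi.single i 1) v (by simp)

section Moments

variable [IsProbabilityMeasure μ] [μ.IsMulLeftInvariant] {v : n → ℂ}

/-- First moments of the squared coordinates of a Haar-random unit vector. -/
theorem integral_norm_sq_mulVec_apply (hv : star v ⬝ᵥ v = 1) (i : n) :
    ∫ U : unitaryGroup n ℂ, ‖((U : Matrix n n ℂ) *ᵥ v) i‖ ^ 2 ∂μ = 1 / Fintype.card n := by
  have : Nonempty n := ⟨i⟩
  have h : ∫ U : unitaryGroup n ℂ, ∑ j, ‖((U : Matrix n n ℂ) *ᵥ v) j‖ ^ 2 ∂μ = 1 := by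
    simp [sum_norm_sq_mulVec _ hv]
  rw [integral_finsetSum _ fun j _ =>
      integrable_comp_mulVec μ (g := fun z => ‖z j‖ ^ 2) (by fun_prop) v,
    Finset.sum_congr rfl fun j _ =>
      integral_comp_mulVec_apply_eq μ (fun x => ‖x‖ ^ 2) j i v] at h
  rw [eq_div_iff (by simp)]
  simpa [mul_comm] using h

/-- Mixed second moments are half of the diagonal ones. -/
theorem two_mul_integral_norm_sq_mul_norm_sq {i j : n} (hij : i ≠ j) :
    2 * ∫ U : unitaryGroup n ℂ,
        ‖((U : Matrix n n ℂ) *ᵥ v) i‖ ^ 2 * ‖((U : Matrix n n ℂ) *ᵥ v) j‖ ^ 2 ∂μ =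
      ∫ U : unitaryGroup n ℂ, ‖((U : Matrix n n ℂ) *ᵥ v) i‖ ^ 4 ∂μ := by
  have key (c : ℂ) (hc : star c * c = 1) :
      ∫ U : unitaryGroup n ℂ,
          ‖((U : Matrix n n ℂ) *ᵥ v) i + c * ((U : Matrix n n ℂ) *ᵥ v) j‖ ^ 4 ∂μ =
        4 * ∫ U : unitaryGroup n ℂ, ‖((U : Matrix n n ℂ) *ᵥ v) i‖ ^ 4 ∂μ := by
    have hs : ((√2 : ℝ) : ℂ) * ((√2 : ℝ) : ℂ) = 2 := by
      rw [← Complex.ofReal_mul, Real.mul_self_sqrt (by norm_num)]; simp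
    have hs0 : ((√2 : ℝ) : ℂ) ≠ 0 := by simp
    have hn : ‖((√2 : ℝ) : ℂ)⁻¹‖ ^ 4 = 1 / 4 := by
      rw [norm_inv, Complex.norm_real, Real.norm_of_nonneg (by positivity), inv_pow,
        show (√2) ^ 4 = ((√2) ^ 2) ^ 2 by ring, Real.sq_sqrt (by norm_num)]
      norm_num
    have h := integral_comp_dotProduct_mulVec μ (fun x => ‖x‖ ^ 4) i
      (((√2 : ℝ) : ℂ)⁻¹ • (Pi.single i 1 + Pi.single j (star c))) v (by
        have hc' : c * star c = 1 := by rw [mul_comm, hc]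
        simp [hij, hij.symm] at hc' ⊢
        rw [mul_assoc _ c, hc']
        field_simp
        linear_combination -hs)
    simp only [star_smul, star_add, ← Pi.single_star, star_one, smul_dotProduct,
      add_dotProduct, single_dotProduct, one_mul, smul_eq_mul, norm_mul, mul_pow, star_inv₀,
      RCLike.star_def, Complex.conj_ofReal, Complex.conj_conj, hn, integral_const_mul] at h
    linarith
  have int (c : ℂ) : Integrable (fun U : unitaryGroup n ℂ =>
      ‖((U : Matrix n n ℂ) *ᵥ v) i + c * ((U : Matrix n n ℂ) *ᵥ v) j‖ ^ 4) μ :=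
    integrable_comp_mulVec μ (g := fun z => ‖z i + c * z j‖ ^ 4) (by fun_prop) v
  have int4 (k : n) : Integrable (fun U : unitaryGroup n ℂ =>
      ‖((U : Matrix n n ℂ) *ᵥ v) k‖ ^ 4) μ :=
    integrable_comp_mulVec μ (g := fun z => ‖z k‖ ^ 4) (by fun_prop) v
  have int44 : Integrable (fun U : unitaryGroup n ℂ =>
      ‖((U : Matrix n n ℂ) *ᵥ v) i‖ ^ 4 + ‖((U : Matrix n n ℂ) *ᵥ v) j‖ ^ 4) μ :=
    (int4 i).add (int4 j)
  have int22 : Integrable (fun U : unitaryGroup n ℂ =>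
      4 * (‖((U : Matrix n n ℂ) *ᵥ v) i‖ ^ 2 * ‖((U : Matrix n n ℂ) *ᵥ v) j‖ ^ 2)) μ :=
    integrable_comp_mulVec μ (g := fun z => 4 * (‖z i‖ ^ 2 * ‖z j‖ ^ 2)) (by fun_prop) v
  have h := integral_finsetSum (Finset.range 4) fun k _ => int (Complex.I ^ k)
  simp only [Complex.sum_norm_add_I_pow_mul_pow_four] at h
  rw [Finset.sum_congr rfl fun k _ => key (Complex.I ^ k) (by simp [← mul_pow]),
    integral_const_mul, integral_add int44 int22,
    integral_add (int4 i) (int4 j), integral_const_mul,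
    integral_comp_mulVec_apply_eq μ (fun x => ‖x‖ ^ 4) j i v] at h
  simp at h
  linarith

theorem integral_norm_sq_mul_norm_sq_eq_ite (i j : n) :
    ∫ U : unitaryGroup n ℂ,
        ‖((U : Matrix n n ℂ) *ᵥ v) i‖ ^ 2 * ‖((U : Matrix n n ℂ) *ᵥ v) j‖ ^ 2 ∂μ =
      (∫ U : unitaryGroup n ℂ, ‖((U : Matrix n n ℂ) *ᵥ v) i‖ ^ 4 ∂μ) / 2 *
        (1 + if i = j then 1 else 0) := by
  split_ifs with h
  · subst h
    simp only [← pow_add]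
    ring
  · rw [← two_mul_integral_norm_sq_mul_norm_sq μ h]
    ring

/-- Second moment of a real combination of the squared coordinates, in terms of a fourth
moment. -/
theorem integral_sum_mul_norm_sq_sq_eq_fourth_moment (c : n → ℝ) (k : n) :
    ∫ U : unitaryGroup n ℂ, (∑ i, c i * ‖((U : Matrix n n ℂ) *ᵥ v) i‖ ^ 2) ^ 2 ∂μ =
      (∫ U : unitaryGroup n ℂ, ‖((U : Matrix n n ℂ) *ᵥ v) k‖ ^ 4 ∂μ) / 2 *
        ((∑ i, c i) ^ 2 + ∑ i, c i ^ 2) := by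
  have hexp (z : n → ℂ) : (∑ i, c i * ‖z i‖ ^ 2) ^ 2 =
      ∑ i, ∑ j, c i * c j * (‖z i‖ ^ 2 * ‖z j‖ ^ 2) := by
    rw [sq, Finset.sum_mul_sum]
    exact Finset.sum_congr rfl fun i _ => Finset.sum_congr rfl fun j _ => by ring
  simp only [hexp]
  rw [integral_finsetSum _ fun i _ => integrable_comp_mulVec μ
    (g := fun z => ∑ j, c i * c j * (‖z i‖ ^ 2 * ‖z j‖ ^ 2)) (by fun_prop) v]
  have (i : n) := integral_finsetSum (μ := μ) Finset.univ fun j _ => integrable_comp_mulVec μ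
    (g := fun z => c i * c j * (‖z i‖ ^ 2 * ‖z j‖ ^ 2)) (by fun_prop) v
  simp only [this, integral_const_mul, integral_norm_sq_mul_norm_sq_eq_ite]
  simp only [integral_comp_mulVec_apply_eq μ (fun x => ‖x‖ ^ 4) _ k v]
  generalize (∫ U : unitaryGroup n ℂ, ‖((U : Matrix n n ℂ) *ᵥ v) k‖ ^ 4 ∂μ) / 2 = a
  rw [sq (∑ i, c i), Finset.sum_mul_sum]
  simp only [mul_add, Finset.sum_add_distrib, Finset.mul_sum]
  congr 1
  · exact Finset.sum_congr rfl fun i _ => Finset.sum_congr rfl fun j _ => by ring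
  · simp
    exact Finset.sum_congr rfl fun i _ => by ring

theorem integral_sum_mul_norm_sq (hv : star v ⬝ᵥ v = 1) (c : n → ℝ) :
    ∫ U : unitaryGroup n ℂ, ∑ i, c i * ‖((U : Matrix n n ℂ) *ᵥ v) i‖ ^ 2 ∂μ =
      (∑ i, c i) / Fintype.card n := by
  rw [integral_finsetSum _ fun i _ => integrable_comp_mulVec μ
    (g := fun z => c i * ‖z i‖ ^ 2) (by fun_prop) v]
  simp only [integral_const_mul, integral_norm_sq_mulVec_apply μ hv, Finset.sum_div, mul_one_div]

theorem integral_sum_mul_norm_sq_sq (hv : star v ⬝ᵥ v = 1) (c : n → ℝ) :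
    ∫ U : unitaryGroup n ℂ, (∑ i, c i * ‖((U : Matrix n n ℂ) *ᵥ v) i‖ ^ 2) ^ 2 ∂μ =
      ((∑ i, c i) ^ 2 + ∑ i, c i ^ 2) / (Fintype.card n * (Fintype.card n + 1)) := by
  rcases isEmpty_or_nonempty n with _ | ⟨⟨k⟩⟩
  · simp
  have : Nonempty n := ⟨k⟩
  have h1 := integral_sum_mul_norm_sq_sq_eq_fourth_moment μ (v := v) (fun _ => 1) k
  simp [sum_norm_sq_mulVec _ hv] at h1
  rw [integral_sum_mul_norm_sq_sq_eq_fourth_moment μ c k, eq_div_iff (by positivity)]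
  linear_combination (-((∑ i, c i) ^ 2 + ∑ i, c i ^ 2)) * h1

end Moments

end Matrix.UnitaryGroup

/-- for the Haar probability measure `μ` on `U(d)`, a rank-one
orthogonal projection `ρ`, and a traceless Hermitian `A`, the Haar average of
`Tr(U ρ U* A)` vanishes and its variance is `Tr(A²)/(d(d+1)) ≤ ‖A‖_HS²/d²`;
in particular if moreover `A² = I` (as for a Pauli string) the variance is
`1/(d+1)`. -/
theorem stmt11 (d : ℕ) (hd : 1 ≤ d)
    [MeasurableSpace (Matrix.unitaryGroup (Fin d) ℂ)]
    [BorelSpace (Matrix.unitaryGroup (Fin d) ℂ)]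
    (μ : Measure (Matrix.unitaryGroup (Fin d) ℂ))
    [μ.IsHaarMeasure] [IsProbabilityMeasure μ]
    (ρ : Matrix (Fin d) (Fin d) ℂ)
    (hρ : ρ.IsHermitian) (hρ2 : ρ * ρ = ρ) (hρrank : ρ.rank = 1)
    (A : Matrix (Fin d) (Fin d) ℂ) (hA : A.IsHermitian) (hAtr : A.trace = 0) :
    (∫ U : Matrix.unitaryGroup (Fin d) ℂ,
        ((U : Matrix (Fin d) (Fin d) ℂ) * ρ * star (U : Matrix (Fin d) (Fin d) ℂ) * A).trace ∂μ
      = 0) ∧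
    (∫ U : Matrix.unitaryGroup (Fin d) ℂ,
        ((U : Matrix (Fin d) (Fin d) ℂ) * ρ * star (U : Matrix (Fin d) (Fin d) ℂ) * A).trace ^ 2 ∂μ
      = (A * A).trace / (d * (d + 1))) ∧
    (((A * A).trace / (d * (d + 1)) : ℂ).re ≤
      Real.sqrt (((Aᴴ * A).trace).re) ^ 2 / d ^ 2) ∧
    (A * A = 1 →
      ∫ U : Matrix.unitaryGroup (Fin d) ℂ,
        ((U : Matrix (Fin d) (Fin d) ℂ) * ρ * star (U : Matrix (Fin d) (Fin d) ℂ) * A).trace ^ 2 ∂μ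
      = 1 / (d + 1)) := by
  obtain ⟨v, hv, rfl⟩ := exists_eq_vecMulVec_of_rank_eq_one hρ hρ2 hρrank
  have hsum : ∑ i, hA.eigenvalues i = 0 := by
    have := hA.trace_eq_sum_eigenvalues
    rw [hAtr] at this
    exact Complex.ofReal_injective (by simpa using this.symm)
  have hvar : ∫ U : Matrix.unitaryGroup (Fin d) ℂ,
      ((U : Matrix (Fin d) (Fin d) ℂ) * vecMulVec v (star v) *
        star (U : Matrix (Fin d) (Fin d) ℂ) * A).trace ^ 2 ∂μ =
      (A * A).trace / (d * (d + 1)) := by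
    simp only [trace_conj_vecMulVec_mul]
    rw [← UnitaryGroup.integral_comp_mulVec_mulVec μ
      (fun z => (star z ⬝ᵥ (A *ᵥ z)) ^ 2) hA.eigenvectorUnitary v]
    simp only [hA.star_dotProduct_mulVec_eigenvectorUnitary, ← Complex.ofReal_pow]
    rw [integral_complex_ofReal, UnitaryGroup.integral_sum_mul_norm_sq_sq μ hv, hsum,
      hA.trace_mul_self_eq_sum_eigenvalues_sq]
    simp
  have hd0 : (0 : ℝ) < d := by exact_mod_cast hd
  refine ⟨?_, hvar, ?_, fun h => ?_⟩
  · simp only [trace_conj_vecMulVec_mul]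
    rw [← UnitaryGroup.integral_comp_mulVec_mulVec μ
      (fun z => star z ⬝ᵥ (A *ᵥ z)) hA.eigenvectorUnitary v]
    simp only [hA.star_dotProduct_mulVec_eigenvectorUnitary]
    rw [integral_complex_ofReal, UnitaryGroup.integral_sum_mul_norm_sq μ hv, hsum]
    simp
  · rw [hA.eq, hA.trace_mul_self_eq_sum_eigenvalues_sq, Complex.ofReal_re]
    have h0 : 0 ≤ ∑ i, hA.eigenvalues i ^ 2 := Finset.sum_nonneg fun _ _ => by positivity
    rw [Real.sq_sqrt h0]
    have : (((∑ i, hA.eigenvalues i ^ 2 : ℝ) : ℂ) / (d * (d + 1))).re =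
        (∑ i, hA.eigenvalues i ^ 2) / (d * (d + 1)) := by
      rw [← Complex.ofReal_re ((∑ i, hA.eigenvalues i ^ 2) / (d * (d + 1)))]
      push_cast
      rfl
    rw [this]
    gcongr
    nlinarith
  · have hd0 : (d : ℂ) ≠ 0 := by exact_mod_cast hd0.ne'
    rw [hvar, h, trace_one, Fintype.card_fin, div_mul_eq_div_div, div_self hd0]
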